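/- arXiv:2210.13011 — 6 statements merged into one kernel-verified Lean document; each statement's English description precedes it below -/
import Mathlib

section
/- Let S and A be nonempty finite types, p₀ a probability mass function on S, π a policy, g : S → A → ℝ, and p_t : S → A → S → ℝ a transition kernel (a probability mass function on S for each (s,a)). Consider the joint law in which s₀ ∼ p₀; a¹,…,aᴺ are i.i.d. from π(·|s₀); s_t ∼ p_t(·|s₀, a¹) (the follow-up state depends only on the first action); and b¹,…,bᴺ are i.i.d. from π(·|s_t). Let G_N(s₀,a) = (1/N)∑ₙ g(s₀,aⁿ) and G_N(s_t,b) = (1/N)∑ₘ g(s_t,bᵐ). Then Cov[G_N(s₀,a), G_N(s_t,b)] = C_marg + (1/N)·C_pol, where, writing ḡ(s) = ∑_a π(a|s)g(s,a), m(s₀,a) = ∑_{s'} p_t(s'|s₀,a)·ḡ(s'), and m̄(s₀) = ∑_a π(a|s₀)·m(s₀,a): C_marg = ∑_{s₀} p₀(s₀)·ḡ(s₀)·m̄(s₀) − (∑_{s₀} p₀(s₀)·ḡ(s₀))·(∑_{s₀} p₀(s₀)·m̄(s₀)), and C_pol = ∑_{s₀} p₀(s₀)·( ∑_a π(a|s₀)·g(s₀,a)·m(s₀,a)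 − ḡ(s₀)·m̄(s₀) ). -/
open Finset

section ProductWeights

variable {ι A : Type*} [Fintype ι] [DecidableEq ι] [Fintype A] {w : A → ℝ}

/-- The marginal of a product weight at one coordinate. -/
lemma sum_prod_weight_mul_apply (hw : ∑ x, w x = 1) (f : A → ℝ) (i : ι) :
    ∑ a : ι → A, (∏ n, w (a n)) * f (a i) = ∑ x, w x * f x := by
  have h := (Fintype.prod_sum (fun (n : ι) (x : A) => w x * if n = i then f x else 1)).symm
  have hn : ∀ n : ι, ∑ x, (w x * if n = i then f x else 1) =
      if n = i then ∑ x, w x * f x else 1 := by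
    intro n
    split_ifs <;> simp [hw]
  simpa only [hn, prod_mul_distrib, prod_ite_eq', mem_univ, if_true] using h

/-- Distinct coordinates are independent under a product weight. -/
lemma sum_prod_weight_mul_apply_mul_apply (hw : ∑ x, w x = 1) (f h : A → ℝ) {i j : ι}
    (hij : i ≠ j) :
    ∑ a : ι → A, (∏ n, w (a n)) * (f (a i) * h (a j)) =
      (∑ x, w x * f x) * ∑ x, w x * h x := by
  have key := (Fintype.prod_sum (fun (n : ι) (x : A) =>
    w x * ((if n = i then f x else 1) * if n = j then h x else 1))).symm
  have hn : ∀ n : ι,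
      ∑ x, w x * ((if n = i then f x else 1) * if n = j then h x else 1) =
        (if n = i then ∑ x, w x * f x else 1) * if n = j then ∑ x, w x * h x else 1 := by
    intro n
    by_cases h1 : n = i
    · subst h1
      simp [hij]
    · simp only [h1, if_false, one_mul]
      split_ifs <;> simp [hw]
  simpa only [hn, prod_mul_distrib, prod_ite_eq', mem_univ, if_true] using key

lemma sum_prod_weight [Nonempty ι] (hw : ∑ x, w x = 1) :
    ∑ a : ι → A, ∏ n, w (a n) = 1 := by
  simpa [hw] using sum_prod_weight_mul_apply hw (fun _ => 1) (Classical.arbitrary ι)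

/-- The sample mean is unbiased. -/
lemma sum_prod_weight_mul_mean {N : ℕ} (hN : 0 < N) (hw : ∑ x, w x = 1) (f : A → ℝ) :
    ∑ a : Fin N → A, (∏ n, w (a n)) * ((1 / (N : ℝ)) * ∑ n, f (a n)) = ∑ x, w x * f x := by
  have hN' : (N : ℝ) ≠ 0 := by positivity
  calc _ = (1 / (N : ℝ)) * ∑ n, ∑ a : Fin N → A, (∏ k, w (a k)) * f (a n) := by
        rw [sum_comm, mul_sum]
        refine sum_congr rfl fun a _ => ?_
        rw [← mul_sum]
        ring
    _ = _ := by
        simp only [sum_prod_weight_mul_apply hw, sum_const, card_univ, Fintype.card_fin,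
          nsmul_eq_mul]
        field_simp

/-- Correlation of the sample mean with a function of a single sample. -/
lemma sum_prod_weight_mul_mean_mul_apply {N : ℕ} (hw : ∑ x, w x = 1)
    (f h : A → ℝ) (i : Fin N) :
    ∑ a : Fin N → A, (∏ n, w (a n)) * (((1 / (N : ℝ)) * ∑ n, f (a n)) * h (a i)) =
      (∑ x, w x * f x) * (∑ x, w x * h x) +
        (1 / (N : ℝ)) * ((∑ x, w x * f x * h x) - (∑ x, w x * f x) * ∑ x, w x * h x) := by
  have hN' : (N : ℝ) ≠ 0 := Nat.cast_ne_zero.mpr i.pos.ne'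
  have hterm : ∀ n : Fin N, ∑ a : Fin N → A, (∏ k, w (a k)) * (f (a n) * h (a i)) =
      (∑ x, w x * f x) * (∑ x, w x * h x) +
        if n = i then (∑ x, w x * f x * h x) - (∑ x, w x * f x) * ∑ x, w x * h x else 0 := by
    intro n
    split_ifs with hni
    · subst hni
      simp [sum_prod_weight_mul_apply hw (fun x => f x * h x), mul_assoc]
    · rw [sum_prod_weight_mul_apply_mul_apply hw f h hni, add_zero]
  calc _ = (1 / (N : ℝ)) * ∑ n, ∑ a : Fin N → A, (∏ k, w (a k)) * (f (a n) * h (a i)) := by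
        rw [sum_comm, mul_sum]
        refine sum_congr rfl fun a _ => ?_
        rw [← mul_sum, ← sum_mul]
        ring
    _ = _ := by
        simp only [hterm, sum_add_distrib, sum_ite_eq', mem_univ, if_true, sum_const, card_univ,
          Fintype.card_fin, nsmul_eq_mul]
        field_simp

end ProductWeights

/-- Covariance decomposition of the many-actions estimator at lag `t`:
`Cov[G_N(s₀,a), G_N(s_t,b)] = C_marg + (1/N)·C_pol`, where the follow-up state `s_t`
depends only on the first action `a¹`. -/
theorem many_actions_covariance_decomposition
    {S A : Type*} [Fintype S] [Fintype A] [Nonempty S] [Nonempty A]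
    (p0 : S → ℝ) (hp0 : ∀ s, 0 ≤ p0 s) (hp0sum : ∑ s, p0 s = 1)
    (π : S → A → ℝ) (hπ : ∀ s a, 0 ≤ π s a) (hπsum : ∀ s, ∑ a, π s a = 1)
    (pt : S → A → S → ℝ) (hpt : ∀ s a s', 0 ≤ pt s a s')
    (hptsum : ∀ s a, ∑ s', pt s a s' = 1)
    (g : S → A → ℝ) (N : ℕ) (hN : 0 < N) :
    -- Cov[G_N(s₀,a), G_N(s_t,b)] = E[G_N(s₀,a)·G_N(s_t,b)] − E[G_N(s₀,a)]·E[G_N(s_t,b)]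
    (∑ s0, ∑ a : Fin N → A, ∑ st, ∑ b : Fin N → A,
        p0 s0 * (∏ n, π s0 (a n)) * pt s0 (a ⟨0, hN⟩) st * (∏ m, π st (b m)) *
          (((1 / (N : ℝ)) * ∑ n, g s0 (a n)) * ((1 / (N : ℝ)) * ∑ m, g st (b m))))
      - (∑ s0, ∑ a : Fin N → A, ∑ st, ∑ b : Fin N → A,
          p0 s0 * (∏ n, π s0 (a n)) * pt s0 (a ⟨0, hN⟩) st * (∏ m, π st (b m)) *
            ((1 / (N : ℝ)) * ∑ n, g s0 (a n)))
        * (∑ s0, ∑ a : Fin N → A, ∑ st, ∑ b : Fin N → A,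
            p0 s0 * (∏ n, π s0 (a n)) * pt s0 (a ⟨0, hN⟩) st * (∏ m, π st (b m)) *
              ((1 / (N : ℝ)) * ∑ m, g st (b m)))
    = -- C_marg
      ((∑ s0, p0 s0 * (∑ a, π s0 a * g s0 a) *
          (∑ a, π s0 a * ∑ s', pt s0 a s' * (∑ a', π s' a' * g s' a')))
        - (∑ s0, p0 s0 * (∑ a, π s0 a * g s0 a)) *
            (∑ s0, p0 s0 * (∑ a, π s0 a * ∑ s', pt s0 a s' * (∑ a', π s' a' * g s' a'))))
      -- + (1/N) · C_pol
      + (1 / (N : ℝ)) *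
          ∑ s0, p0 s0 *
            ((∑ a, π s0 a * g s0 a * ∑ s', pt s0 a s' * (∑ a', π s' a' * g s' a'))
              - (∑ a, π s0 a * g s0 a) *
                  (∑ a, π s0 a * ∑ s', pt s0 a s' * (∑ a', π s' a' * g s' a'))) := by
  have : Nonempty (Fin N) := ⟨⟨0, hN⟩⟩
  have hprod : ∀ s, ∑ b : Fin N → A, ∏ m, π s (b m) = 1 := fun s => sum_prod_weight (hπsum s)
  have hmean : ∀ s, ∑ b : Fin N → A, (∏ m, π s (b m)) * ((1 / (N : ℝ)) * ∑ m, g s (b m)) =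
      ∑ a, π s a * g s a := fun s => sum_prod_weight_mul_mean hN (hπsum s) (g s)
  have integrate : ∀ (X : S → (Fin N → A) → ℝ) (Y : S → (Fin N → A) → ℝ),
      (∑ s0, ∑ a : Fin N → A, ∑ st, ∑ b : Fin N → A,
        p0 s0 * (∏ n, π s0 (a n)) * pt s0 (a ⟨0, hN⟩) st * (∏ m, π st (b m)) *
          (X s0 a * Y st b)) =
      ∑ s0, p0 s0 * ∑ a : Fin N → A, (∏ n, π s0 (a n)) *
        (X s0 a * ∑ st, pt s0 (a ⟨0, hN⟩) st * ∑ b : Fin N → A, (∏ m, π st (b m)) * Y st b) := by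
    intro X Y
    simp only [mul_sum]
    refine sum_congr rfl fun s0 _ => sum_congr rfl fun a _ => sum_congr rfl fun st _ =>
      sum_congr rfl fun b _ => ?_
    ring
  have hprodmean := integrate (fun s a => (1 / (N : ℝ)) * ∑ n, g s (a n))
    (fun s b => (1 / (N : ℝ)) * ∑ m, g s (b m))
  have hfirst := integrate (fun s a => (1 / (N : ℝ)) * ∑ n, g s (a n)) (fun _ _ => 1)
  have hsecond := integrate (fun _ _ => 1) (fun s b => (1 / (N : ℝ)) * ∑ m, g s (b m))
  simp only [mul_one, one_mul, hprod, hptsum, hmean] at hprodmean hfirst hsecond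
  rw [hprodmean, hfirst, hsecond]
  have hcorr := fun s => sum_prod_weight_mul_mean_mul_apply (hπsum s) (g s)
    (fun a => ∑ s', pt s a s' * ∑ a', π s' a' * g s' a') ⟨0, hN⟩
  have hlater := fun s => sum_prod_weight_mul_apply (hπsum s)
    (fun a => ∑ s', pt s a s' * ∑ a', π s' a' * g s' a') (⟨0, hN⟩ : Fin N)
  simp only [hcorr, hlater, mul_add, sum_add_distrib]
  rw [mul_sum (a := 1 / (N : ℝ))]
  simp only [mul_left_comm (1 / (N : ℝ)), ← mul_assoc (p0 _)]
  ring
end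

section
/- Let S and A be nonempty finite types, p₀ a probability mass function on S, π a policy, and g : S → A → ℝ. For every N ≥ 1, the variance of the (N+1)-action estimator G_{N+1} is less than or equal to the variance of the N-action estimator G_N; in particular, for every N ≥ 1 the variance of the N-action estimator is less than or equal to the variance of the single-action estimator G_1. -/
open Finset

/-- The variance of the `N`-action estimator
`G_N(s, a₁,…,a_N) = (1/N)·∑ₙ g(s,aₙ)` under the joint law where `s ∼ p₀` and
`a₁,…,a_N` are i.i.d. from `π(·|s)`. -/
noncomputable def manyActionsVariance {S A : Type*} [Fintype S] [Fintype A]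
    (p0 : S → ℝ) (π : S → A → ℝ) (g : S → A → ℝ) (N : ℕ) : ℝ :=
  (∑ s, ∑ a : Fin N → A,
      p0 s * (∏ n, π s (a n)) * ((1 / (N : ℝ)) * ∑ n, g s (a n)) ^ 2)
    - (∑ s, ∑ a : Fin N → A,
        p0 s * (∏ n, π s (a n)) * ((1 / (N : ℝ)) * ∑ n, g s (a n))) ^ 2

section IIDMoments

variable {A : Type*} [Fintype A] (w f : A → ℝ)

lemma sum_fin_succ_arrow (n : ℕ) (F : (Fin (n + 1) → A) → ℝ) :
    ∑ a, F a = ∑ x : A, ∑ a : Fin n → A, F (Fin.cons x a) := by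
  rw [← (Fin.consEquiv fun _ : Fin (n + 1) => A).sum_comp F, Fintype.sum_prod_type]
  rfl

variable {w}

lemma sum_prod_iid (hw : ∑ a, w a = 1) (n : ℕ) :
    ∑ a : Fin n → A, ∏ i, w (a i) = 1 := by
  simpa [hw] using (Fintype.sum_pow w n).symm

lemma sum_prod_mul_sum_iid (hw : ∑ a, w a = 1) (n : ℕ) :
    ∑ a : Fin n → A, (∏ i, w (a i)) * ∑ i, f (a i) = n * ∑ a, w a * f a := by
  induction n with
  | zero => simp
  | succ n ih =>
    have hsplit (x : A) : ∑ a : Fin n → A, (w x * ∏ i, w (a i)) * (f x + ∑ i, f (a i)) =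
        w x * f x + w x * (n * ∑ a, w a * f a) := by
      calc _ = w x * f x * ∑ a : Fin n → A, ∏ i, w (a i) +
            w x * ∑ a : Fin n → A, (∏ i, w (a i)) * ∑ i, f (a i) := by
            simp only [Finset.mul_sum (s := (univ : Finset (Fin n → A))),
              ← Finset.sum_add_distrib]
            exact Finset.sum_congr rfl fun a _ => by ring
        _ = _ := by rw [sum_prod_iid hw, ih, mul_one]
    simp only [sum_fin_succ_arrow, Fin.prod_univ_succ, Fin.sum_univ_succ, Fin.cons_zero,
      Fin.cons_succ, hsplit]
    rw [Finset.sum_add_distrib, ← Finset.sum_mul, hw]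
    push_cast
    ring

lemma sum_prod_mul_sum_sq_iid (hw : ∑ a, w a = 1) (n : ℕ) :
    ∑ a : Fin n → A, (∏ i, w (a i)) * (∑ i, f (a i)) ^ 2 =
      n * ∑ a, w a * f a ^ 2 + n * (n - 1) * (∑ a, w a * f a) ^ 2 := by
  induction n with
  | zero => simp
  | succ n ih =>
    have hsplit (x : A) : ∑ a : Fin n → A, (w x * ∏ i, w (a i)) * (f x + ∑ i, f (a i)) ^ 2 =
        w x * f x ^ 2 + w x * f x * (2 * (n * ∑ a, w a * f a)) +
          w x * (n * ∑ a, w a * f a ^ 2 + n * (n - 1) * (∑ a, w a * f a) ^ 2) := by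
      calc _ = w x * f x ^ 2 * ∑ a : Fin n → A, ∏ i, w (a i) +
            w x * f x * (2 * ∑ a : Fin n → A, (∏ i, w (a i)) * ∑ i, f (a i)) +
            w x * ∑ a : Fin n → A, (∏ i, w (a i)) * (∑ i, f (a i)) ^ 2 := by
            simp only [Finset.mul_sum (s := (univ : Finset (Fin n → A))),
              ← Finset.sum_add_distrib]
            exact Finset.sum_congr rfl fun a _ => by ring
        _ = _ := by rw [sum_prod_iid hw, sum_prod_mul_sum_iid f hw, ih, mul_one]
    simp only [sum_fin_succ_arrow, Fin.prod_univ_succ, Fin.sum_univ_succ, Fin.cons_zero,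
      Fin.cons_succ, hsplit]
    rw [Finset.sum_add_distrib, Finset.sum_add_distrib, ← Finset.sum_mul, ← Finset.sum_mul, hw]
    push_cast
    ring

lemma sq_sum_mul_le_sum_mul_sq (hw0 : ∀ a, 0 ≤ w a) (hw : ∑ a, w a = 1) :
    (∑ a, w a * f a) ^ 2 ≤ ∑ a, w a * f a ^ 2 := by
  simpa using (even_two.convexOn_pow (𝕜 := ℝ)).map_sum_le (t := univ) (w := w) (p := f)
    (fun a _ => hw0 a) hw (fun _ _ => Set.mem_univ _)

end IIDMoments

/-- The law of total variance for `G_N`: the variance of the conditional mean plus `1 / N` times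
the mean of the conditional variance. -/
lemma manyActionsVariance_eq {S A : Type*} [Fintype S] [Fintype A]
    (p0 : S → ℝ) (π : S → A → ℝ) (hπsum : ∀ s, ∑ a, π s a = 1) (g : S → A → ℝ)
    {N : ℕ} (hN : 1 ≤ N) :
    manyActionsVariance p0 π g N =
      (∑ s, p0 s * (∑ a, π s a * g s a) ^ 2 - (∑ s, p0 s * ∑ a, π s a * g s a) ^ 2) +
        (1 / (N : ℝ)) *
          ∑ s, p0 s * (∑ a, π s a * g s a ^ 2 - (∑ a, π s a * g s a) ^ 2) := by
  have hN0 : (N : ℝ) ≠ 0 := by positivity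
  have hmean (s : S) : ∑ a : Fin N → A,
      p0 s * (∏ n, π s (a n)) * ((1 / (N : ℝ)) * ∑ n, g s (a n)) =
        p0 s * ∑ a, π s a * g s a := by
    calc _ = p0 s * (1 / (N : ℝ)) *
          ∑ a : Fin N → A, (∏ n, π s (a n)) * ∑ n, g s (a n) := by
          rw [Finset.mul_sum]
          exact Finset.sum_congr rfl fun a _ => by ring
      _ = _ := by
          rw [sum_prod_mul_sum_iid (g s) (hπsum s)]
          field_simp
  have hsq (s : S) : ∑ a : Fin N → A,
      p0 s * (∏ n, π s (a n)) * ((1 / (N : ℝ)) * ∑ n, g s (a n)) ^ 2 =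
        p0 s * (∑ a, π s a * g s a) ^ 2 + (1 / (N : ℝ)) *
          (p0 s * (∑ a, π s a * g s a ^ 2 - (∑ a, π s a * g s a) ^ 2)) := by
    calc _ = p0 s * (1 / (N : ℝ)) ^ 2 *
          ∑ a : Fin N → A, (∏ n, π s (a n)) * (∑ n, g s (a n)) ^ 2 := by
          rw [Finset.mul_sum]
          exact Finset.sum_congr rfl fun a _ => by ring
      _ = _ := by
          rw [sum_prod_mul_sum_sq_iid (g s) (hπsum s)]
          field_simp
          ring
  simp only [manyActionsVariance, hmean, hsq]
  rw [Finset.sum_add_distrib, ← Finset.mul_sum]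
  ring

lemma manyActionsVariance_anti {S A : Type*} [Fintype S] [Fintype A]
    (p0 : S → ℝ) (hp0 : ∀ s, 0 ≤ p0 s)
    (π : S → A → ℝ) (hπ : ∀ s a, 0 ≤ π s a) (hπsum : ∀ s, ∑ a, π s a = 1)
    (g : S → A → ℝ) {M N : ℕ} (hM : 1 ≤ M) (hMN : M ≤ N) :
    manyActionsVariance p0 π g N ≤ manyActionsVariance p0 π g M := by
  rw [manyActionsVariance_eq p0 π hπsum g hM, manyActionsVariance_eq p0 π hπsum g (hM.trans hMN)]
  have hvar : 0 ≤ ∑ s, p0 s * (∑ a, π s a * g s a ^ 2 - (∑ a, π s a * g s a) ^ 2) :=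
    Finset.sum_nonneg fun s _ => mul_nonneg (hp0 s) <|
      sub_nonneg.2 <| sq_sum_mul_le_sum_mul_sq (g s) (hπ s) (hπsum s)
  gcongr

/-- For every `N ≥ 1`, the variance of the `(N+1)`-action estimator
is at most the variance of the `N`-action estimator; in particular, the variance of the
`N`-action estimator is at most the variance of the single-action estimator `G_1`. -/
theorem many_actions_variance_monotone
    {S A : Type*} [Fintype S] [Fintype A] [Nonempty S] [Nonempty A]
    (p0 : S → ℝ) (hp0 : ∀ s, 0 ≤ p0 s) (hp0sum : ∑ s, p0 s = 1)
    (π : S → A → ℝ) (hπ : ∀ s a, 0 ≤ π s a) (hπsum : ∀ s, ∑ a, π s a = 1)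
    (g : S → A → ℝ) :
    ∀ N : ℕ, 1 ≤ N →
      manyActionsVariance p0 π g (N + 1) ≤ manyActionsVariance p0 π g N ∧
      manyActionsVariance p0 π g N ≤ manyActionsVariance p0 π g 1 := by
  intro N hN
  exact ⟨manyActionsVariance_anti p0 hp0 π hπ hπsum g hN N.le_succ,
    manyActionsVariance_anti p0 hp0 π hπ hπsum g le_rfl hN⟩
end

section
/- Let T ≥ 1 and m ≥ 1 be natural numbers, set δ = m/T, let v ∈ ℝ, and let C : ℕ → ℝ satisfy C(t) = 0 for all t ≥ T. Define for every natural T' ≥ 1 the single-level SPG variance W(T') = (1/T')·v + 2·∑_{t=1}^{T'−1} ((T'−t)/T'²)·C(t). Then the variance reduction from extending the trajectory satisfies W(T+m) − W(T) = (−δ/(T + δT))·( v + 2·∑_{t=1}^{T−1} ( (T−t)/T − t/(T+δT) )·C(t) ). -/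
open Finset

/-- Variance reduction from extending the trajectory: with
`W(T') = (1/T')·v + 2·∑_{t=1}^{T'−1} ((T'−t)/T'²)·C(t)`, `δ = m/T`, and `C(t) = 0` for
`t ≥ T` (regenerative trajectory), one has
`W(T+m) − W(T) = (−δ/(T+δT))·(v + 2·∑_{t=1}^{T−1} ((T−t)/T − t/(T+δT))·C(t))`. -/
theorem variance_reduction_from_longer_trajectory
    (T m : ℕ) (hT : 1 ≤ T) (hm : 1 ≤ m) (v : ℝ) (C : ℕ → ℝ)
    (hC : ∀ t, T ≤ t → C t = 0) :
    ((1 / ((T + m : ℕ) : ℝ)) * v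
        + 2 * ∑ t ∈ Finset.Ico 1 (T + m),
            ((((T + m : ℕ) : ℝ) - t) / ((T + m : ℕ) : ℝ) ^ 2) * C t)
      - ((1 / (T : ℝ)) * v
          + 2 * ∑ t ∈ Finset.Ico 1 T, (((T : ℝ) - t) / (T : ℝ) ^ 2) * C t)
    = (-(((m : ℝ) / T)) / ((T : ℝ) + ((m : ℝ) / T) * T)) *
        (v + 2 * ∑ t ∈ Finset.Ico 1 T,
            ((((T : ℝ) - t) / T) - t / ((T : ℝ) + ((m : ℝ) / T) * T)) * C t) := by
  have hT0 : (T : ℝ) ≠ 0 := by positivity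
  have hS0 : (T : ℝ) + m ≠ 0 := by positivity
  have htail : ∑ t ∈ Finset.Ico 1 (T + m),
        ((((T + m : ℕ) : ℝ) - t) / ((T + m : ℕ) : ℝ) ^ 2) * C t
      = ∑ t ∈ Finset.Ico 1 T,
        ((((T + m : ℕ) : ℝ) - t) / ((T + m : ℕ) : ℝ) ^ 2) * C t := by
    symm
    apply Finset.sum_subset (Finset.Ico_subset_Ico_right (Nat.le_add_right T m))
    intro t ht hnt
    rw [hC t (by simp only [Finset.mem_Ico] at ht hnt; omega), mul_zero]
  have hdiff : ∑ t ∈ Finset.Ico 1 T,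
        ((((T + m : ℕ) : ℝ) - t) / ((T + m : ℕ) : ℝ) ^ 2) * C t
      - ∑ t ∈ Finset.Ico 1 T, (((T : ℝ) - t) / (T : ℝ) ^ 2) * C t
      = (-((m : ℝ) / T) / ((T : ℝ) + m)) *
        ∑ t ∈ Finset.Ico 1 T, ((((T : ℝ) - t) / T) - t / ((T : ℝ) + m)) * C t := by
    rw [← Finset.sum_sub_distrib, Finset.mul_sum]
    refine Finset.sum_congr rfl fun t _ => ?_
    push_cast
    field_simp
    ring
  have hv : 1 / ((T + m : ℕ) : ℝ) - 1 / (T : ℝ) = -((m : ℝ) / T) / ((T : ℝ) + m) := by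
    push_cast
    field_simp
    ring
  rw [htail, div_mul_cancel₀ (m : ℝ) hT0]
  linear_combination v * hv + 2 * hdiff
end

section
/- Let T ≥ 1 and N ≥ 1 be natural numbers, δ > 0 a real number, v_e, v ∈ ℝ, and α_e, α : ℕ → ℝ. Set Δ_N = (−1/(T·(N²+N)))·( v + 2·∑_{t=1}^{T−1} ((T−t)/T)·α(t) ) and Δ_T = (−δ/(T + δT))·( (v_e + v/N) + 2·∑_{t=1}^{T−1} ( (T−t)/T − t/(T+δT) )·(α_e(t) + α(t)/N) ). Then −Δ_N ≥ −Δ_T if and only if ((1 − δN)/(δ·(N² + N)))·v + 2·∑_{t=1}^{T−1} ( ((1 + δ − δN − δ²N)·T − (1 − 2δN − δ²N)·t) / ((δT + δ²T)·(N² + N)) )·α(t) ≥ v_e + 2·∑_{t=1}^{T−1} ( (T−t)/T − t/(T+δT) )·α_e(t). -/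
open Finset

/-- General many-actions optimality condition (Equation 17 of the
paper): for trajectory length `T ≥ 1`, `N ≥ 1` action samples per state, and relative
cost `δ > 0`, the variance reduction from one more action sample dominates that from
extending the trajectory by `δT` states, `−Δ_N ≥ −Δ_T`, iff the stated inequality between
the policy-dependent and marginalized components holds. -/
theorem general_many_actions_optimality_condition
    (T N : ℕ) (hT : 1 ≤ T) (hN : 1 ≤ N) (δ : ℝ) (hδ : 0 < δ)
    (ve v : ℝ) (αe α : ℕ → ℝ) :
    -(((-1 : ℝ) / ((T : ℝ) * ((N : ℝ) ^ 2 + N))) *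
        (v + 2 * ∑ t ∈ Finset.Ico 1 T, (((T : ℝ) - t) / T) * α t))
      ≥ -((-δ / ((T : ℝ) + δ * T)) *
          ((ve + v / N) + 2 * ∑ t ∈ Finset.Ico 1 T,
              ((((T : ℝ) - t) / T) - t / ((T : ℝ) + δ * T)) * (αe t + α t / N)))
    ↔ ((1 - δ * N) / (δ * ((N : ℝ) ^ 2 + N))) * v
        + 2 * ∑ t ∈ Finset.Ico 1 T,
            (((1 + δ - δ * N - δ ^ 2 * N) * T - (1 - 2 * δ * N - δ ^ 2 * N) * t) /
                ((δ * T + δ ^ 2 * T) * ((N : ℝ) ^ 2 + N))) * α t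
      ≥ ve + 2 * ∑ t ∈ Finset.Ico 1 T,
          ((((T : ℝ) - t) / T) - t / ((T : ℝ) + δ * T)) * αe t := by
  have hT0 : (0 : ℝ) < T := by exact_mod_cast hT
  have hN0 : (0 : ℝ) < N := by exact_mod_cast hN
  have hδ1 : (0 : ℝ) < 1 + δ := by linarith
  have hNN : (N : ℝ) ^ 2 + N = N * (N + 1) := by ring
  have hTδ : (T : ℝ) + δ * T = T * (1 + δ) := by ring
  have hTδ' : δ * (T : ℝ) + δ ^ 2 * T = δ * T * (1 + δ) := by ring
  have hsplit : ∑ t ∈ Finset.Ico 1 T,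
        ((((T : ℝ) - t) / T) - t / ((T : ℝ) + δ * T)) * (αe t + α t / N)
      = ∑ t ∈ Finset.Ico 1 T, ((((T : ℝ) - t) / T) - t / ((T : ℝ) + δ * T)) * αe t
        + (∑ t ∈ Finset.Ico 1 T, ((((T : ℝ) - t) / T) - t / ((T : ℝ) + δ * T)) * α t) / N := by
    rw [Finset.sum_div, ← Finset.sum_add_distrib]
    exact Finset.sum_congr rfl fun t _ => by ring
  have hcoeff : ∑ t ∈ Finset.Ico 1 T,
        (((1 + δ - δ * N - δ ^ 2 * N) * T - (1 - 2 * δ * N - δ ^ 2 * N) * t) /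
          ((δ * T + δ ^ 2 * T) * ((N : ℝ) ^ 2 + N))) * α t
      = (1 + δ) / (δ * ((N : ℝ) ^ 2 + N)) * ∑ t ∈ Finset.Ico 1 T, (((T : ℝ) - t) / T) * α t
        - (∑ t ∈ Finset.Ico 1 T, ((((T : ℝ) - t) / T) - t / ((T : ℝ) + δ * T)) * α t) / N := by
    rw [Finset.mul_sum, Finset.sum_div, ← Finset.sum_sub_distrib]
    refine Finset.sum_congr rfl fun t _ => ?_
    rw [hNN, hTδ, hTδ']
    field_simp
    ring
  rw [hsplit, hcoeff]
  generalize ∑ t ∈ Finset.Ico 1 T, ((((T : ℝ) - t) / T) - t / ((T : ℝ) + δ * T)) * αe t = A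
  generalize ∑ t ∈ Finset.Ico 1 T, ((((T : ℝ) - t) / T) - t / ((T : ℝ) + δ * T)) * α t = B
  generalize ∑ t ∈ Finset.Ico 1 T, (((T : ℝ) - t) / T) * α t = C
  have hscale : 0 < δ / ((T : ℝ) + δ * T) := by positivity
  rw [ge_iff_le, ge_iff_le, ← mul_le_mul_iff_right₀ hscale (b := ve + 2 * A), ← sub_nonneg,
    ← sub_nonneg (b := _ * (ve + 2 * A))]
  refine iff_of_eq (congrArg (fun x : ℝ => 0 ≤ x) ?_)
  rw [hNN, hTδ]
  field_simp
  ring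
end

section
/- Let T ≥ 1 and N ≥ 1 be natural numbers, δ > 0 a real number, and v_e, v ∈ ℝ with v > 0. Set Δ_N = (−1/(T·(N²+N)))·v and Δ_T = (−δ/(T + δT))·(v_e + v/N) (the contextual-bandit case, in which all covariance terms are zero). Then −Δ_N ≥ −Δ_T if and only if v_e / v ≤ (1 − δN)/(δ·(N² + N)). -/
/-- Contextual-bandit many-actions optimality condition
(Corollary 3.4 of the paper): with all covariance terms zero,
`−Δ_N ≥ −Δ_T` iff `v_e / v ≤ (1 − δN)/(δ·(N²+N))`. -/
theorem contextual_bandit_optimality_condition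
    (T N : ℕ) (hT : 1 ≤ T) (hN : 1 ≤ N) (δ : ℝ) (hδ : 0 < δ)
    (ve v : ℝ) (hv : 0 < v) :
    -(((-1 : ℝ) / ((T : ℝ) * ((N : ℝ) ^ 2 + N))) * v)
      ≥ -((-δ / ((T : ℝ) + δ * T)) * (ve + v / N))
    ↔ ve / v ≤ (1 - δ * N) / (δ * ((N : ℝ) ^ 2 + N)) := by
  have hT' : (0 : ℝ) < T := by exact_mod_cast hT
  have hN' : (0 : ℝ) < N := by exact_mod_cast hN
  have hδ' : 0 < 1 + δ := by linarith
  have key : -(((-1 : ℝ) / ((T : ℝ) * ((N : ℝ) ^ 2 + N))) * v)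
      - -((-δ / ((T : ℝ) + δ * T)) * (ve + v / N))
      = ((1 - δ * N) * v - ve * (δ * ((N : ℝ) ^ 2 + N)))
        / (T * (1 + δ) * (N * (N + 1))) := by
    rw [show (T : ℝ) + δ * T = T * (1 + δ) by ring,
      show (N : ℝ) ^ 2 + N = N * (N + 1) by ring]
    field_simp
    ring
  rw [ge_iff_le, ← sub_nonneg, key, div_le_div_iff₀ hv (by positivity),
    le_div_iff₀ (by positivity), zero_mul, sub_nonneg]
end

section
/- Let S and A be nonempty finite types, p₀ a probability mass function on S, π a policy, g : S → A → ℝ, and for each t ∈ ℕ let p_t : S → A → S → ℝ be a transition kernel. Define the lag-t SPG covariance Cov_t = ∑_{s₀,a₀,s_t,a_t} p₀(s₀)·π(a₀|s₀)·p_t(s_t|s₀,a₀)·π(a_t|s_t)·g(s₀,a₀)·g(s_t,a_t) − (∑_{s,a} p₀(s)·π(a|s)·g(s,a))·(∑_{s₀,a₀,s_t,a_t} p₀(s₀)·π(a₀|s₀)·p_t(s_t|s₀,a₀)·π(a_t|s_t)·g(s_t,a_t)). If for all s₀ ∈ S, a₀ ∈ A, and s' ∈ S one has p_t(s'|s₀,a₀)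 → p₀(s') as t → ∞, then Cov_t → 0 as t → ∞. -/
open Finset Filter

/-- If the `t`-step transition kernel converges pointwise to the
stationary distribution `p₀` (ergodicity), then the lag-`t` SPG covariance tends to `0`
as `t → ∞`. -/
theorem lag_covariance_tendsto_zero
    {S A : Type*} [Fintype S] [Fintype A] [Nonempty S] [Nonempty A]
    (p0 : S → ℝ) (hp0 : ∀ s, 0 ≤ p0 s) (hp0sum : ∑ s, p0 s = 1)
    (π : S → A → ℝ) (hπ : ∀ s a, 0 ≤ π s a) (hπsum : ∀ s, ∑ a, π s a = 1)
    (g : S → A → ℝ)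
    (pt : ℕ → S → A → S → ℝ) (hpt : ∀ t s a s', 0 ≤ pt t s a s')
    (hptsum : ∀ t s a, ∑ s', pt t s a s' = 1)
    (hconv : ∀ s0 a0 s', Tendsto (fun t => pt t s0 a0 s') atTop (nhds (p0 s'))) :
    Tendsto
      (fun t =>
        (∑ s0, ∑ a0, ∑ st, ∑ a1,
            p0 s0 * π s0 a0 * pt t s0 a0 st * π st a1 * g s0 a0 * g st a1)
          - (∑ s, ∑ a, p0 s * π s a * g s a) *
              (∑ s0, ∑ a0, ∑ st, ∑ a1,
                p0 s0 * π s0 a0 * pt t s0 a0 st * π st a1 * g st a1))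
      atTop (nhds 0) := by
  have key : ∀ f : S → A → ℝ,
      ∑ s0, ∑ a0, ∑ st, ∑ a1, p0 s0 * π s0 a0 * p0 st * π st a1 * f s0 a0 * g st a1 =
        (∑ s, ∑ a, p0 s * π s a * f s a) * ∑ s, ∑ a, p0 s * π s a * g s a := by
    intro f
    simp only [Finset.sum_mul]
    refine Finset.sum_congr rfl fun s0 _ => Finset.sum_congr rfl fun a0 _ => ?_
    simp only [Finset.mul_sum]
    exact Finset.sum_congr rfl fun st _ => Finset.sum_congr rfl fun a1 _ => by ring
  have total : ∑ s, ∑ a, p0 s * π s a = 1 := by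
    simp [← Finset.mul_sum, hπsum, hp0sum]
  have hlim : (∑ s0, ∑ a0, ∑ st, ∑ a1,
        p0 s0 * π s0 a0 * p0 st * π st a1 * g s0 a0 * g st a1)
      - (∑ s, ∑ a, p0 s * π s a * g s a) *
          (∑ s0, ∑ a0, ∑ st, ∑ a1, p0 s0 * π s0 a0 * p0 st * π st a1 * g st a1) = 0 := by
    have h := key fun _ _ => 1
    simp only [mul_one, total, one_mul] at h
    rw [key g, h, sub_self]
  rw [← hlim]
  refine Tendsto.sub ?_ (Tendsto.const_mul _ ?_)
  · exact tendsto_finsetSum _ fun s0 _ => tendsto_finsetSum _ fun a0 _ =>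
      tendsto_finsetSum _ fun st _ => tendsto_finsetSum _ fun a1 _ =>
        ((((hconv s0 a0 st).const_mul _).mul_const _).mul_const _).mul_const _
  · exact tendsto_finsetSum _ fun s0 _ => tendsto_finsetSum _ fun a0 _ =>
      tendsto_finsetSum _ fun st _ => tendsto_finsetSum _ fun a1 _ =>
        (((hconv s0 a0 st).const_mul _).mul_const _).mul_const _
end
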